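/- There is an absolute constant C > 0 such that for every odd integer k ≥ 1 and all s, t ∈ [−1,1], |M_k(s) − M_k(t)| ≤ C·√k·|s − t|; that is, the k-wise majority function M_k is O(√k)-Lipschitz on [−1,1]. -/

import Mathlib

/-- `sign(x) = 1` if `x ≥ 0` and `−1` otherwise. -/
noncomputable def rsign (x : ℝ) : ℝ := if 0 ≤ x then 1 else -1

/-- The `k`-wise majority function
`M_k(t) = Σ_{j=0}^k sign(2j−k)·C(k,j)·((1+t)/2)^j·((1−t)/2)^{k−j}`. -/
noncomputable def Mk (k : ℕ) (t : ℝ) : ℝ :=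
  ∑ j ∈ Finset.range (k+1),
    rsign (2*(j:ℝ) - (k:ℝ)) * (Nat.choose k j : ℝ) * ((1+t)/2)^j * ((1-t)/2)^(k-j)

open Polynomial in
lemma bern_tele (n r : ℕ) :
    derivative (∑ j ∈ Finset.range (r+1), bernsteinPolynomial ℝ n j)
      = -(n : ℝ[X]) * bernsteinPolynomial ℝ (n-1) r := by
  induction r with
  | zero => simp [bernsteinPolynomial.derivative_zero]
  | succ r ih =>
    rw [Finset.sum_range_succ, derivative_add, ih, bernsteinPolynomial.derivative_succ]
    ring

lemma cb_bound (m : ℕ) : (2*(m:ℝ)+1) * (Nat.centralBinom m : ℝ)^2 ≤ 16^m := by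
  induction m with
  | zero => simp
  | succ m ih =>
    have h : ((m:ℝ)+1) * (Nat.centralBinom (m+1) : ℝ) = 2*(2*m+1) * Nat.centralBinom m := by
      exact_mod_cast Nat.succ_mul_centralBinom_succ m
    have hm : (0:ℝ) < ((m:ℝ)+1)^2 := by positivity
    refine le_of_mul_le_mul_left ?_ hm
    have e : ((m:ℝ)+1)^2 * ((2*((m+1:ℕ):ℝ)+1) * (Nat.centralBinom (m+1) : ℝ)^2)
        = (4*(2*m+3)*(2*m+1)) * ((2*(m:ℝ)+1) * (Nat.centralBinom m : ℝ)^2) := by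
      push_cast
      linear_combination (2*(m:ℝ)+3) * (((m:ℝ)+1) * (Nat.centralBinom (m+1) : ℝ)
        + 2*(2*m+1) * Nat.centralBinom m) * h
    rw [e, pow_succ (16:ℝ) m]
    have h2 : (4*(2*(m:ℝ)+3)*(2*m+1)) ≤ 16*((m:ℝ)+1)^2 := by nlinarith
    calc _ ≤ (16*((m:ℝ)+1)^2) * 16^m := by gcongr
      _ = _ := by ring

open Polynomial in
lemma Mk_eq (m : ℕ) (t : ℝ) : Mk (2*m+1) t =
    1 - 2 * (∑ j ∈ Finset.range (m+1), bernsteinPolynomial ℝ (2*m+1) j).eval ((1+t)/2) := by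
  have hs := congrArg (eval ((1+t)/2)) (bernsteinPolynomial.sum ℝ (2*m+1))
  have hsp : ∀ f : ℕ → ℝ, ∑ j ∈ Finset.range (2*m+1+1), f j
      = ∑ j ∈ Finset.range (m+1), f j + ∑ j ∈ Finset.range (m+1), f (m+1+j) := by
    intro f
    rw [show 2*m+1+1 = (m+1)+(m+1) by ring, Finset.sum_range_add]
  rw [eval_finsetSum, hsp, eval_one] at hs
  rw [Mk, hsp, eval_finsetSum]
  have key : ∀ j, (bernsteinPolynomial ℝ (2*m+1) j).eval ((1+t)/2)
      = (Nat.choose (2*m+1) j : ℝ) * ((1+t)/2)^j * ((1-t)/2)^(2*m+1-j) := by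
    intro j
    simp only [bernsteinPolynomial, eval_mul, eval_natCast, eval_pow, eval_X, eval_sub, eval_one]
    congr 2
    ring
  have h1 : ∑ j ∈ Finset.range (m+1), rsign (2*(j:ℝ) - ((2*m+1:ℕ):ℝ)) *
      (Nat.choose (2*m+1) j : ℝ) * ((1+t)/2)^j * ((1-t)/2)^(2*m+1-j)
      = - ∑ j ∈ Finset.range (m+1), (bernsteinPolynomial ℝ (2*m+1) j).eval ((1+t)/2) := by
    rw [← Finset.sum_neg_distrib]
    refine Finset.sum_congr rfl fun j hj => ?_
    have : (j:ℝ) ≤ m := by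
      have := Finset.mem_range.1 hj
      exact_mod_cast (by omega : j ≤ m)
    rw [key, rsign, if_neg (by push_cast; linarith)]
    ring
  have h2 : ∑ j ∈ Finset.range (m+1), rsign (2*((m+1+j:ℕ):ℝ) - ((2*m+1:ℕ):ℝ)) *
      (Nat.choose (2*m+1) (m+1+j) : ℝ) * ((1+t)/2)^(m+1+j) * ((1-t)/2)^(2*m+1-(m+1+j))
      = ∑ j ∈ Finset.range (m+1), (bernsteinPolynomial ℝ (2*m+1) (m+1+j)).eval ((1+t)/2) := by
    refine Finset.sum_congr rfl fun j hj => ?_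
    have : (0:ℝ) ≤ j := by positivity
    rw [key, rsign, if_pos (by push_cast; linarith)]
    ring
  rw [h1, h2]
  linarith

open Polynomial in
lemma Mk_deriv (m : ℕ) (t : ℝ) : HasDerivAt (Mk (2*m+1))
    ((2*m+1) * (Nat.centralBinom m : ℝ) * (((1+t)/2) * ((1-t)/2))^m) t := by
  rw [show Mk (2*m+1) = _ from funext (Mk_eq m)]
  have h1 : HasDerivAt (fun t : ℝ => (1+t)/2) (1/2) t :=
    ((hasDerivAt_id t).const_add 1).div_const 2
  have h := (((∑ j ∈ Finset.range (m+1), bernsteinPolynomial ℝ (2*m+1) j).hasDerivAt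
    ((1+t)/2)).comp t h1).const_mul 2 |>.const_sub 1
  refine h.congr_deriv ?_
  rw [bern_tele]
  simp only [bernsteinPolynomial, eval_mul, eval_neg, eval_natCast, eval_pow, eval_X, eval_sub,
    eval_one, Nat.add_sub_cancel, Nat.centralBinom_eq_two_mul_choose]
  rw [show 2*m-m = m by omega, mul_pow, show 1-(1+t)/2 = (1-t)/2 by ring]
  push_cast
  ring

lemma Mk_bound (m : ℕ) (t : ℝ) (ht : t ∈ Set.Icc (-1:ℝ) 1) :
    ‖(2*m+1) * (Nat.centralBinom m : ℝ) * (((1+t)/2) * ((1-t)/2))^m‖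
      ≤ Real.sqrt ((2*m+1 : ℕ):ℝ) := by
  obtain ⟨h1, h2⟩ := ht
  have h0 : 0 ≤ ((1+t)/2) * ((1-t)/2) := mul_nonneg (by linarith) (by linarith)
  have h4 : ((1+t)/2) * ((1-t)/2) ≤ 1/4 := by nlinarith [sq_nonneg t]
  rw [Real.norm_of_nonneg (by positivity)]
  apply Real.le_sqrt_of_sq_le
  push_cast
  calc _ ≤ ((2*m+1) * (Nat.centralBinom m : ℝ) * (1/4)^m)^2 := by gcongr
    _ = (2*m+1) * ((2*(m:ℝ)+1) * (Nat.centralBinom m : ℝ)^2) * (1/16)^m := by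
      rw [show (1/16:ℝ)^m = ((1/4)^m)^2 by rw [← pow_mul, mul_comm m 2, pow_mul]; norm_num]; ring
    _ ≤ (2*m+1) * 16^m * (1/16)^m := by gcongr; exact cb_bound m
    _ = 2*m+1 := by rw [mul_assoc, ← mul_pow]; norm_num

/-- There is an absolute constant `C > 0` such that for every odd `k ≥ 1`,
`M_k` is `C·√k`-Lipschitz on `[−1,1]`. -/
theorem stmt6 : ∃ C : ℝ, 0 < C ∧
    ∀ k : ℕ, Odd k → 1 ≤ k →
    ∀ s ∈ Set.Icc (-1:ℝ) 1, ∀ t ∈ Set.Icc (-1:ℝ) 1,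
      |Mk k s - Mk k t| ≤ C * Real.sqrt k * |s - t| := by
  refine ⟨1, one_pos, ?_⟩
  rintro k ⟨m, rfl⟩ - s hs t ht
  rw [one_mul]
  exact (convex_Icc (-1:ℝ) 1).norm_image_sub_le_of_norm_hasDerivWithin_le
    (fun x _ => (Mk_deriv m x).hasDerivWithinAt) (fun x hx => Mk_bound m x hx) ht hs
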